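/- Let G be a connected unbalanced signed graph with n vertices, m edges, and a fixed linear order ≺ on its edge set E. Then every subset F ⊆ E that contains no broken bond of G as a subset satisfies |F| ≤ m−n, and is contained in some subset F' ⊆ E with |F'| = m−n that also contains no broken bond of G as a subset. (Equivalently, the collection of broken-bond-free edge subsets of G is a homogeneous simplicial complex whose maximal faces all have cardinality m−n.) -/

import Mathlib

/-- A signed graph: each edge `e` has endpoints `a e`, `b e` (equal for a loop)
and a sign `sign e ∈ {1, -1}`. -/
structure SignedGraph (V E : Type) where
  a : E → V
  b : E → V
  sign : E → ℤ
  sign_unit : ∀ e, sign e = 1 ∨ sign e = -1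

namespace SignedGraph

variable {V E : Type}

/-- An orientation of a signed graph: incidence signs `ηa e`, `ηb e ∈ {1,-1}` at the
two ends of each edge, with `ηa e * ηb e = - sign e`. -/
structure Orientation (G : SignedGraph V E) where
  ηa : E → ℤ
  ηb : E → ℤ
  ηa_unit : ∀ e, ηa e = 1 ∨ ηa e = -1
  ηb_unit : ∀ e, ηb e = 1 ∨ ηb e = -1
  compat : ∀ e, ηa e * ηb e = - G.sign e

/-- Kirchhoff's law at every vertex: a `Γ`-flow. -/
def IsFlow [Fintype E] [DecidableEq V] {Γ : Type} [AddCommGroup Γ]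
    (G : SignedGraph V E) (O : G.Orientation) (f : E → Γ) : Prop :=
  ∀ v : V, ∑ e : E,
    ((if G.a e = v then O.ηa e else 0) + (if G.b e = v then O.ηb e else 0)) • f e = 0

/-- Degree of a vertex in the subgraph with edge set `S` (a loop counts twice). -/
def deg [DecidableEq V] (G : SignedGraph V E) (S : Finset E) (v : V) : ℕ :=
  ∑ e ∈ S, ((if G.a e = v then 1 else 0) + (if G.b e = v then 1 else 0))

/-- Adjacency via an edge in the edge set `S`. -/
def AdjIn (G : SignedGraph V E) (S : Finset E) (v w : V) : Prop :=
  ∃ e ∈ S, (G.a e = v ∧ G.b e = w) ∨ (G.a e = w ∧ G.b e = v)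

/-- A circuit: a nonempty edge set forming a connected 2-regular subgraph. -/
def IsCircuit [DecidableEq V] (G : SignedGraph V E) (C : Finset E) : Prop :=
  C.Nonempty ∧
  (∀ v : V, (∃ e ∈ C, G.a e = v ∨ G.b e = v) → G.deg C v = 2) ∧
  (∀ v w : V, (∃ e ∈ C, G.a e = v ∨ G.b e = v) → (∃ e ∈ C, G.a e = w ∨ G.b e = w) →
     Relation.ReflTransGen (G.AdjIn C) v w)

/-- An unbalanced circuit: a circuit with an odd number of negative edges. -/
def IsUnbalancedCircuit [DecidableEq V] (G : SignedGraph V E) (C : Finset E) : Prop :=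
  G.IsCircuit C ∧ Odd (C.filter (fun e => G.sign e = -1)).card

/-- The subgraph with edge set `S` is balanced (contains no unbalanced circuit). -/
def BalancedOn [DecidableEq V] (G : SignedGraph V E) (S : Finset E) : Prop :=
  ∀ C : Finset E, C ⊆ S → ¬ G.IsUnbalancedCircuit C

/-- A balanced signed graph: contains no unbalanced circuit. -/
def Balanced [DecidableEq V] (G : SignedGraph V E) : Prop :=
  ∀ C : Finset E, ¬ G.IsUnbalancedCircuit C

/-- An unbalanced signed graph: contains an unbalanced circuit. -/
def Unbalanced [DecidableEq V] (G : SignedGraph V E) : Prop :=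
  ∃ C : Finset E, G.IsUnbalancedCircuit C

/-- Adjacency in the whole signed graph. -/
def Adj (G : SignedGraph V E) (v w : V) : Prop :=
  ∃ e : E, (G.a e = v ∧ G.b e = w) ∨ (G.a e = w ∧ G.b e = v)

/-- A connected signed graph: every two vertices are joined by a walk. -/
def Connected (G : SignedGraph V E) : Prop :=
  ∀ v w : V, Relation.ReflTransGen G.Adj v w

/-- The setoid on vertices whose classes are the connected components. -/
def compSetoid (G : SignedGraph V E) : Setoid V :=
  ⟨Relation.EqvGen G.Adj, Relation.EqvGen.is_equivalence _⟩

/-- The connected component of a vertex. -/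
def component (G : SignedGraph V E) (v : V) : Quotient G.compSetoid :=
  Quotient.mk G.compSetoid v

/-- The number of vertices of a connected component. -/
noncomputable def compN (G : SignedGraph V E) (q : Quotient G.compSetoid) : ℕ :=
  Nat.card {v : V // G.component v = q}

/-- The number of edges of a connected component. -/
noncomputable def compM (G : SignedGraph V E) (q : Quotient G.compSetoid) : ℕ :=
  Nat.card {e : E // G.component (G.a e) = q}

/-- The connected component `q` is unbalanced (contains an unbalanced circuit). -/
def CompUnbalanced [DecidableEq V] (G : SignedGraph V E) (q : Quotient G.compSetoid) : Prop :=
  ∃ C : Finset E, G.IsUnbalancedCircuit C ∧ ∃ e ∈ C, G.component (G.a e) = q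

open Classical in
/-- `β` of a connected component: `m - n` if unbalanced, `m - n + 1` if balanced. -/
noncomputable def compBeta [DecidableEq V] (G : SignedGraph V E)
    (q : Quotient G.compSetoid) : ℕ :=
  if G.CompUnbalanced q then G.compM q - G.compN q else G.compM q + 1 - G.compN q

/-- `β(G)`: the sum of `β(ω)` over the connected components `ω` of `G`. -/
noncomputable def beta [DecidableEq V] (G : SignedGraph V E) : ℕ :=
  ∑ᶠ q : Quotient G.compSetoid, G.compBeta q

/-- `κ(G)`: the number of unbalanced connected components of `G`. -/
noncomputable def kappa [DecidableEq V] (G : SignedGraph V E) : ℕ :=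
  Nat.card {q : Quotient G.compSetoid // G.CompUnbalanced q}

/-- The signed graph `G - F` obtained by deleting the edges in `F` (all vertices kept). -/
def delete [DecidableEq E] (G : SignedGraph V E) (F : Finset E) :
    SignedGraph V {e : E // e ∉ F} :=
  ⟨fun e => G.a e.1, fun e => G.b e.1, fun e => G.sign e.1, fun e => G.sign_unit e.1⟩

/-- The edges with both endpoints in `X` (the edge set of `G[X]`). -/
def insideEdges [Fintype E] [DecidableEq V] (G : SignedGraph V E) (X : Finset V) : Finset E :=
  Finset.univ.filter (fun e => G.a e ∈ X ∧ G.b e ∈ X)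

/-- The edges with one endpoint in `X` and one outside: `[X, Xᶜ]`. -/
def crossEdges [Fintype E] [DecidableEq V] (G : SignedGraph V E) (X : Finset V) : Finset E :=
  Finset.univ.filter (fun e => (G.a e ∈ X ∧ G.b e ∉ X) ∨ (G.a e ∉ X ∧ G.b e ∈ X))

/-- A cut: a nonempty set `B = [X, Xᶜ] ∪ E_X` where `X` is a nonempty vertex set and `E_X`
is a set of edges of `G[X]` minimal with `G[X] - E_X` balanced. -/
def IsCut [Fintype E] [DecidableEq V] [DecidableEq E]
    (G : SignedGraph V E) (B : Finset E) : Prop :=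
  B.Nonempty ∧ ∃ X : Finset V, X.Nonempty ∧ ∃ EX : Finset E,
    EX ⊆ G.insideEdges X ∧
    G.BalancedOn (G.insideEdges X \ EX) ∧
    (∀ EX' ⊆ EX, G.BalancedOn (G.insideEdges X \ EX') → EX' = EX) ∧
    B = G.crossEdges X ∪ EX

/-- A bond: a cut that is minimal (under inclusion) among cuts. -/
def IsBond [Fintype E] [DecidableEq V] [DecidableEq E]
    (G : SignedGraph V E) (B : Finset E) : Prop :=
  G.IsCut B ∧ ∀ B' ⊆ B, G.IsCut B' → B' = B

/-- A broken bond: a bond minus its largest edge (w.r.t. the linear order on `E`). -/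
def IsBrokenBond [Fintype E] [DecidableEq V] [LinearOrder E]
    (G : SignedGraph V E) (D : Finset E) : Prop :=
  ∃ B : Finset E, G.IsBond B ∧ ∃ h : B.Nonempty, D = B.erase (B.max' h)

/-- `F` contains no broken bond of `G` as a subset. -/
def NoBrokenBond [Fintype E] [DecidableEq V] [LinearOrder E]
    (G : SignedGraph V E) (F : Finset E) : Prop :=
  ∀ D : Finset E, G.IsBrokenBond D → ¬ D ⊆ F

end SignedGraph

/-- `ε(Γ)`: the largest `d` such that `Γ` has a subgroup isomorphic to `(ℤ/2ℤ)^d`. -/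
noncomputable def epsilon (Γ : Type) [AddCommGroup Γ] [Fintype Γ] : ℕ :=
  sSup {d : ℕ | ∃ H : AddSubgroup Γ, Nonempty (H ≃+ (Fin d → ZMod 2))}

namespace SignedGraph

variable {V E : Type}

/-- A function with values `±1` switching every edge of `S` to a positive edge. -/
def IsSwitching (G : SignedGraph V E) (S : Finset E) (s : V → ℤ) : Prop :=
  (∀ v, s v = 1 ∨ s v = -1) ∧ ∀ e ∈ S, s (G.a e) = G.sign e * s (G.b e)

/-- The functional on `V → ℚ` given by the row of the incidence matrix at the edge `e`. -/
def edgeForm (G : SignedGraph V E) (e : E) : (V → ℚ) →ₗ[ℚ] ℚ :=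
  LinearMap.proj (G.a e) - (G.sign e : ℚ) • LinearMap.proj (G.b e)

@[simp]
lemma edgeForm_apply (G : SignedGraph V E) (e : E) (φ : V → ℚ) :
    G.edgeForm e φ = φ (G.a e) - G.sign e * φ (G.b e) := by
  simp [edgeForm]

/-- The edges of `S` span the frame matroid: only the zero potential is annihilated by `S`. -/
def Spans (G : SignedGraph V E) (S : Finset E) : Prop :=
  ∀ φ : V → ℚ, (∀ e ∈ S, G.edgeForm e φ = 0) → φ = 0

lemma AdjIn.symm {G : SignedGraph V E} {S : Finset E} {v w : V} (h : G.AdjIn S v w) :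
    G.AdjIn S w v := by
  obtain ⟨e, he, h⟩ := h
  exact ⟨e, he, h.symm⟩

lemma reflTransGen_symm (G : SignedGraph V E) {S : Finset E} {v w : V}
    (h : Relation.ReflTransGen (G.AdjIn S) v w) : Relation.ReflTransGen (G.AdjIn S) w v := by
  induction h with
  | refl => exact .refl
  | tail _ h ih => exact .head h.symm ih

lemma reflTransGen_mono (G : SignedGraph V E) {S T : Finset E} (hST : S ⊆ T) {v w : V}
    (h : Relation.ReflTransGen (G.AdjIn S) v w) : Relation.ReflTransGen (G.AdjIn T) v w := by
  induction h with
  | refl => exact .refl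
  | tail _ h ih =>
    obtain ⟨e, he, h⟩ := h
    exact ih.tail ⟨e, hST he, h⟩

lemma reachable_of_reflTransGen (G : SignedGraph V E) (S : Finset E) {v w : V}
    (h : Relation.ReflTransGen (G.AdjIn S) v w) :
    (SimpleGraph.fromRel (G.AdjIn S)).Reachable v w := by
  induction h with
  | refl => exact .refl _
  | @tail x y _ hxy ih =>
    refine ih.trans ?_
    by_cases hne : x = y
    · exact hne ▸ .refl _
    · exact SimpleGraph.Adj.reachable ((SimpleGraph.fromRel_adj _ _ _).2 ⟨hne, .inl hxy⟩)

lemma deg_insert [DecidableEq V] [DecidableEq E] (G : SignedGraph V E) {S : Finset E} {e : E}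
    (he : e ∉ S) (v : V) :
    G.deg (insert e S) v =
      ((if G.a e = v then 1 else 0) + (if G.b e = v then 1 else 0)) + G.deg S v := by
  simp [deg, Finset.sum_insert he]

/-- The edge set of a path, with its degrees and the product of its signs. -/
lemma exists_pathEdges [DecidableEq V] [DecidableEq E] (G : SignedGraph V E) {S : Finset E}
    {s : V → ℤ} (hs : G.IsSwitching S s) {u w : V}
    (p : (SimpleGraph.fromRel (G.AdjIn S)).Walk u w) (hp : p.IsPath) :
    ∃ P ⊆ S, (∀ e ∈ P, G.a e ∈ p.support ∧ G.b e ∈ p.support) ∧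
      (∀ x, G.deg P x + (if u = x then 1 else 0) + (if w = x then 1 else 0)
        = if x ∈ p.support then 2 else 0) ∧
      (∀ x ∈ p.support, Relation.ReflTransGen (G.AdjIn P) u x) ∧
      ∏ e ∈ P, G.sign e = s u * s w := by
  induction p with
  | @nil u =>
    refine ⟨∅, by simp, by simp, fun x => ?_, ?_, ?_⟩
    · by_cases h : u = x
      · subst h; simp [deg]
      · have h' : x ≠ u := fun h' => h h'.symm
        simp [deg, h, h']
    · intro x hx
      simp only [SimpleGraph.Walk.support_nil, List.mem_singleton] at hx
      exact hx ▸ .refl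
    · rcases hs.1 u with h | h <;> simp [h]
  | @cons u v w huv p ih =>
    rw [SimpleGraph.Walk.cons_isPath_iff] at hp
    obtain ⟨P, hPS, hsupp, hdeg, hconn, hprod⟩ := ih hp.1
    obtain ⟨hne, hadj⟩ := (SimpleGraph.fromRel_adj _ _ _).1 huv
    have hadj' : G.AdjIn S u v := hadj.elim id AdjIn.symm
    obtain ⟨e, heS, he⟩ := hadj'
    have heP : e ∉ P := by
      intro h
      rcases he with he | he
      · exact hp.2 (he.1 ▸ (hsupp e h).1)
      · exact hp.2 (he.2 ▸ (hsupp e h).2)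
    refine ⟨insert e P, Finset.insert_subset heS hPS, ?_, ?_, ?_, ?_⟩
    · intro f hf
      simp only [SimpleGraph.Walk.support_cons, List.mem_cons]
      rcases Finset.mem_insert.1 hf with rfl | hf
      · have := p.start_mem_support
        rcases he with ⟨h1, h2⟩ | ⟨h1, h2⟩ <;> simp [h1, h2, this]
      · exact ⟨.inr (hsupp f hf).1, .inr (hsupp f hf).2⟩
    · intro x
      have hx := hdeg x
      rw [G.deg_insert heP]
      simp only [SimpleGraph.Walk.support_cons, List.mem_cons]
      have hends : ((if G.a e = x then 1 else 0) + (if G.b e = x then 1 else 0) : ℕ)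
          = (if u = x then 1 else 0) + (if v = x then 1 else 0) := by
        rcases he with ⟨h1, h2⟩ | ⟨h1, h2⟩
        · rw [h1, h2]
        · rw [h1, h2, add_comm]
      rw [hends]
      by_cases hux : u = x
      · subst hux
        simp only [hp.2, if_false, if_true, true_or] at hx ⊢
        omega
      · have hxu : x ≠ u := fun h => hux h.symm
        simp only [hux, hxu, if_false, false_or] at hx ⊢
        omega
    · intro x hx
      simp only [SimpleGraph.Walk.support_cons, List.mem_cons] at hx
      rcases hx with rfl | hx
      · exact .refl
      · refine .head ⟨e, Finset.mem_insert_self _ _, he⟩ ?_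
        exact G.reflTransGen_mono (Finset.subset_insert e P) (hconn x hx)
    · rw [Finset.prod_insert heP, hprod]
      have hse := hs.2 e heS
      have hsign : G.sign e = s u * s v := by
        rcases G.sign_unit e with h | h <;> rcases hs.1 u with h1 | h1 <;>
          rcases hs.1 v with h2 | h2 <;> rcases he with ⟨h3, h4⟩ | ⟨h3, h4⟩ <;>
          simp_all
      rw [hsign]
      rcases hs.1 v with h | h <;> simp [h]

lemma prod_sign (G : SignedGraph V E) (C : Finset E) :
    ∏ e ∈ C, G.sign e = (-1) ^ (C.filter (fun e => G.sign e = -1)).card := by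
  rw [← Finset.prod_filter_mul_prod_filter_not C (fun e => G.sign e = -1),
    Finset.prod_congr rfl (g := fun _ => (-1 : ℤ)) (fun e he => (Finset.mem_filter.1 he).2),
    Finset.prod_const,
    Finset.prod_eq_one (s := C.filter (fun e => ¬ G.sign e = -1))
      (fun e he => (G.sign_unit e).resolve_right (Finset.mem_filter.1 he).2), mul_one]

lemma odd_iff_prod_sign (G : SignedGraph V E) (C : Finset E) :
    Odd (C.filter (fun e => G.sign e = -1)).card ↔ ∏ e ∈ C, G.sign e = -1 := by
  rw [prod_sign]
  exact (neg_one_pow_eq_neg_one_iff_odd (by decide)).symm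

/-- An edge joining two vertices connected in `S` closes a path in `S` to a circuit. -/
lemma exists_circuit [DecidableEq V] [DecidableEq E] (G : SignedGraph V E) {S : Finset E}
    {s : V → ℤ} (hs : G.IsSwitching S s) {e : E} (heS : e ∉ S)
    (hab : Relation.ReflTransGen (G.AdjIn S) (G.a e) (G.b e)) :
    ∃ C ⊆ insert e S, G.IsCircuit C ∧
      ∏ f ∈ C, G.sign f = G.sign e * (s (G.a e) * s (G.b e)) := by
  obtain ⟨p⟩ := G.reachable_of_reflTransGen S hab
  obtain ⟨P, hPS, hsupp, hdeg, hconn, hprod⟩ :=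
    G.exists_pathEdges hs p.bypass p.bypass_isPath
  have heP : e ∉ P := fun h => heS (hPS h)
  have hmem : ∀ x, (∃ f ∈ insert e P, G.a f = x ∨ G.b f = x) → x ∈ p.bypass.support := by
    rintro x ⟨f, hf, hx⟩
    rcases Finset.mem_insert.1 hf with rfl | hf
    · rcases hx with rfl | rfl
      · exact p.bypass.start_mem_support
      · exact p.bypass.end_mem_support
    · rcases hx with rfl | rfl
      · exact (hsupp f hf).1
      · exact (hsupp f hf).2
  have hreach : ∀ x, (∃ f ∈ insert e P, G.a f = x ∨ G.b f = x) →
      Relation.ReflTransGen (G.AdjIn (insert e P)) (G.a e) x := fun x hx =>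
    G.reflTransGen_mono (Finset.subset_insert e P) (hconn x (hmem x hx))
  refine ⟨insert e P, Finset.insert_subset_insert e hPS,
    ⟨Finset.insert_nonempty _ _, fun x hx => ?_, fun v w hv hw => ?_⟩, ?_⟩
  · have := hdeg x
    rw [if_pos (hmem x hx)] at this
    rw [G.deg_insert heP]
    omega
  · exact (G.reflTransGen_symm (hreach v hv)).trans (hreach w hw)
  · rw [Finset.prod_insert heP, hprod]

/-- **Harary's balance theorem**: a balanced edge set can be switched to be all positive. -/
lemma BalancedOn.exists_isSwitching [DecidableEq V] [DecidableEq E] {G : SignedGraph V E}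
    {S : Finset E} (hS : G.BalancedOn S) : ∃ s, G.IsSwitching S s := by
  classical
  induction S using Finset.induction_on with
  | empty => exact ⟨fun _ => 1, by simp [IsSwitching]⟩
  | insert e S heS ih =>
    obtain ⟨s, hs⟩ := ih fun C hC => hS C (hC.trans (Finset.subset_insert _ _))
    by_cases hse : s (G.a e) = G.sign e * s (G.b e)
    · refine ⟨s, hs.1, fun f hf => ?_⟩
      rcases Finset.mem_insert.1 hf with rfl | hf
      exacts [hse, hs.2 f hf]
    by_cases hab : Relation.ReflTransGen (G.AdjIn S) (G.a e) (G.b e)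
    · obtain ⟨C, hCS, hC, hprod⟩ := G.exists_circuit hs heS hab
      refine (hS C hCS ⟨hC, (G.odd_iff_prod_sign C).2 ?_⟩).elim
      rw [hprod]
      rcases G.sign_unit e with h | h <;> rcases hs.1 (G.a e) with h1 | h1 <;>
        rcases hs.1 (G.b e) with h2 | h2 <;> simp_all
    · refine ⟨fun v => if Relation.ReflTransGen (G.AdjIn S) (G.a e) v then -s v else s v,
        fun v => ?_, fun f hf => ?_⟩
      · rcases hs.1 v with h | h <;> simp only [h] <;> split_ifs <;> simp
      · rcases Finset.mem_insert.1 hf with rfl | hf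
        · have haa : Relation.ReflTransGen (G.AdjIn S) (G.a f) (G.a f) := .refl
          simp only [haa, hab, if_true, if_false]
          rcases G.sign_unit f with h | h <;> rcases hs.1 (G.a f) with h1 | h1 <;>
            rcases hs.1 (G.b f) with h2 | h2 <;> simp_all
        · have hiff : Relation.ReflTransGen (G.AdjIn S) (G.a e) (G.a f) ↔
              Relation.ReflTransGen (G.AdjIn S) (G.a e) (G.b f) :=
            ⟨fun h => h.tail ⟨f, hf, .inl ⟨rfl, rfl⟩⟩, fun h => h.tail ⟨f, hf, .inr ⟨rfl, rfl⟩⟩⟩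
          simp only [hiff, hs.2 f hf]
          split_ifs <;> ring

/-- An edge set that can be switched to be all positive is balanced. -/
lemma IsSwitching.balancedOn [Fintype V] [DecidableEq V] {G : SignedGraph V E} {S : Finset E}
    {s : V → ℤ} (hs : G.IsSwitching S s) : G.BalancedOn S := by
  rintro C hCS ⟨⟨-, hdeg, -⟩, hodd⟩
  rw [odd_iff_prod_sign] at hodd
  have hsign : ∀ e ∈ C, G.sign e =
      ∏ v, s v ^ ((if G.a e = v then 1 else 0) + (if G.b e = v then 1 else 0)) := by
    intro e he
    have hse := hs.2 e (hCS he)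
    simp only [pow_add, Finset.prod_mul_distrib, pow_ite, pow_one, pow_zero,
      Finset.prod_ite_eq, Finset.mem_univ, if_true]
    rcases hs.1 (G.b e) with h | h <;> simp [hse, h]
  rw [Finset.prod_congr rfl hsign, Finset.prod_comm] at hodd
  have hone : ∀ v ∈ Finset.univ,
      ∏ e ∈ C, s v ^ ((if G.a e = v then 1 else 0) + (if G.b e = v then 1 else 0)) = 1 := by
    intro v _
    rw [Finset.prod_pow_eq_pow_sum]
    change s v ^ G.deg C v = 1
    by_cases hv : ∃ e ∈ C, G.a e = v ∨ G.b e = v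
    · rw [hdeg v hv]
      rcases hs.1 v with h | h <;> simp [h]
    · have : G.deg C v = 0 := by
        refine Finset.sum_eq_zero fun e he => ?_
        have h1 : G.a e ≠ v := fun h => hv ⟨e, he, .inl h⟩
        have h2 : G.b e ≠ v := fun h => hv ⟨e, he, .inr h⟩
        simp [h1, h2]
      rw [this, pow_zero]
  rw [Finset.prod_eq_one hone] at hodd
  exact absurd hodd (by decide)

/-- A cut carries a nonzero potential annihilated by all edges outside it. -/
lemma IsCut.not_spans [Fintype E] [DecidableEq V] [DecidableEq E] {G : SignedGraph V E}
    {B : Finset E} (hB : G.IsCut B) : ¬ G.Spans Bᶜ := by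
  obtain ⟨-, X, ⟨x, hx⟩, EX, -, hbal, -, rfl⟩ := hB
  obtain ⟨s, hs⟩ := hbal.exists_isSwitching
  intro hspan
  have h0 := congrFun (hspan (fun v => if v ∈ X then (s v : ℚ) else 0) fun e he => ?_) x
  · rcases hs.1 x with h | h <;> simp [hx, h] at h0
  · simp only [Finset.mem_compl, Finset.mem_union, not_or, crossEdges, Finset.mem_filter,
      Finset.mem_univ, true_and, not_and, not_not] at he
    by_cases ha : G.a e ∈ X
    · have hb := he.1.1 ha
      have hse := hs.2 e (by simp [insideEdges, ha, hb, he.2])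
      simp [ha, hb, hse]
    · have hb : G.b e ∉ X := he.1.2 ha
      simp [ha, hb]

/-- In a connected unbalanced signed graph, a set that does not span misses a whole cut. -/
lemma exists_isCut_disjoint [Fintype V] [Fintype E] [DecidableEq V] [DecidableEq E]
    {G : SignedGraph V E} (hconn : G.Connected) (hunb : G.Unbalanced) {S : Finset E}
    (hS : ¬ G.Spans S) : ∃ B, G.IsCut B ∧ Disjoint B S := by
  classical
  simp only [Spans, not_forall] at hS
  obtain ⟨φ, hφS, hφ⟩ := hS
  simp only [edgeForm_apply, sub_eq_zero] at hφS
  obtain ⟨x, hx⟩ := Function.ne_iff.1 hφ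
  let X : Finset V := Finset.univ.filter fun v => φ v ≠ 0
  have hmem : ∀ v, v ∈ X ↔ φ v ≠ 0 := fun v => by simp [X]
  have hcross : ∀ e ∈ S, (G.a e ∈ X ↔ G.b e ∈ X) := by
    intro e he
    rw [hmem, hmem, hφS e he]
    rcases G.sign_unit e with h | h <;> simp [h]
  have hbal : G.BalancedOn (G.insideEdges X \ (G.insideEdges X \ S)) := by
    refine IsSwitching.balancedOn (s := fun v => if φ v < 0 then -1 else 1)
      ⟨fun v => by dsimp only; split_ifs <;> simp, fun e he => ?_⟩
    simp only [insideEdges, Finset.mem_sdiff, Finset.mem_filter, Finset.mem_univ, true_and,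
      not_and, not_not, hmem] at he
    have heq := hφS e (he.2 he.1)
    have hb := he.1.2
    rcases G.sign_unit e with h | h
    · simp [h, heq]
    · rcases lt_or_gt_of_ne hb with hb | hb
      · have : ¬ (0 < φ (G.b e)) := not_lt.2 hb.le
        simp [h, heq, hb, this]
      · have : ¬ (φ (G.b e) < 0) := not_lt.2 hb.le
        simp [h, heq, hb, this]
  obtain ⟨EX, hEXS, hmin⟩ :=
    exists_minimal_le_of_wellFoundedLT (fun T => G.BalancedOn (G.insideEdges X \ T)) _ hbal
  refine ⟨G.crossEdges X ∪ EX, ⟨?_, X, ⟨x, (hmem x).2 hx⟩, EX,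
    hEXS.trans Finset.sdiff_subset, hmin.prop, fun T hT hTb => ?_, rfl⟩, ?_⟩
  · by_contra hempty
    rw [Finset.not_nonempty_iff_eq_empty, Finset.union_eq_empty] at hempty
    have hclosed : ∀ v w, G.Adj v w → v ∈ X → w ∈ X := by
      rintro v w ⟨e, he⟩ hv
      by_contra hw
      have : e ∈ G.crossEdges X := by
        rcases he with ⟨rfl, rfl⟩ | ⟨rfl, rfl⟩ <;> simp [crossEdges, hv, hw]
      simp [hempty.1] at this
    have hall : ∀ v, v ∈ X := by
      intro v
      induction hconn x v with
      | refl => exact (hmem x).2 hx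
      | tail _ h ih => exact hclosed _ _ h ih
    obtain ⟨C, hC⟩ := hunb
    refine hmin.prop C (fun e _ => ?_) hC
    simp [hempty.2, insideEdges, hall]
  · exact subset_antisymm hT (hmin.le_of_le hTb hT)
  · rw [Finset.disjoint_left]
    intro e he heS
    rcases Finset.mem_union.1 he with he | he
    · have := hcross e heS
      simp only [crossEdges, Finset.mem_filter] at he
      tauto
    · exact (Finset.mem_sdiff.1 (hEXS he)).2 heS

lemma IsCut.exists_isBond_subset [Fintype E] [DecidableEq V] [DecidableEq E]
    {G : SignedGraph V E} {B : Finset E} (hB : G.IsCut B) : ∃ B' ⊆ B, G.IsBond B' := by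
  obtain ⟨B', hle, hmin⟩ := exists_minimal_le_of_wellFoundedLT G.IsCut B hB
  exact ⟨B', hle, hmin.prop, fun D hD hDc => subset_antisymm hD (hmin.le_of_le hDc hD)⟩

/-- A spanning edge set contains a basis of the frame matroid, which has `|V|` elements. -/
lemma Spans.exists_subset_card_eq [Fintype V] [DecidableEq E] {G : SignedGraph V E}
    {S : Finset E} (hS : G.Spans S) :
    ∃ T ⊆ S, T.card = Fintype.card V ∧ G.Spans T := by
  classical
  let f : S → Module.Dual ℚ (V → ℚ) := fun e => G.edgeForm e.1
  have htop : Submodule.span ℚ (Set.range f) = ⊤ := by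
    rw [← Subspace.dualCoannihilator_dualAnnihilator_eq (W := Submodule.span ℚ (Set.range f))]
    have : (Submodule.span ℚ (Set.range f)).dualCoannihilator = ⊥ := by
      rw [eq_bot_iff]
      intro φ hφ
      rw [Submodule.mem_dualCoannihilator] at hφ
      exact hS φ fun e he => hφ _ (Submodule.subset_span ⟨⟨e, he⟩, rfl⟩)
    rw [this, Submodule.dualAnnihilator_bot]
  obtain ⟨κ, g, hg, hspan, hli⟩ := exists_linearIndependent' ℚ f
  have : Finite κ := Finite.of_injective g hg
  have := Fintype.ofFinite κ
  let b := Module.Basis.mk hli (by rw [hspan, htop])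
  refine ⟨Finset.univ.image fun k => (g k).1, ?_, ?_, fun φ hφ => ?_⟩
  · intro e he
    obtain ⟨k, -, rfl⟩ := Finset.mem_image.1 he
    exact (g k).2
  · rw [Finset.card_image_of_injective _ fun _ _ h => hg (Subtype.ext h), Finset.card_univ,
      ← Module.finrank_eq_card_basis b, Subspace.dual_finrank_eq, Module.finrank_fintype_fun_eq_card]
  · refine (Module.forall_dual_apply_eq_zero_iff ℚ φ).1 fun ψ => ?_
    have hψ : ψ ∈ Submodule.span ℚ (Set.range (f ∘ g)) := by rw [hspan, htop]; trivial
    induction hψ using Submodule.span_induction with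
    | mem ψ h =>
      obtain ⟨k, rfl⟩ := h
      exact hφ _ (Finset.mem_image_of_mem _ (Finset.mem_univ k))
    | zero => rfl
    | add _ _ _ _ h1 h2 => simp [h1, h2]
    | smul _ _ _ h => simp [h]

/-- Exchange along a bond meeting a spanning set in a single edge. -/
lemma IsBond.spans_insert_erase [Fintype V] [Fintype E] [DecidableEq V] [DecidableEq E]
    {G : SignedGraph V E} (hconn : G.Connected) (hunb : G.Unbalanced) {B T : Finset E}
    (hB : G.IsBond B) (hT : G.Spans T) {e x : E} (hBT : ∀ y ∈ B, y ∈ T → y = e)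
    (hx : x ∈ B) : G.Spans (insert x (T.erase e)) := by
  by_contra hns
  simp only [Spans, not_forall] at hns
  obtain ⟨ψ, hψT, hψ⟩ := hns
  have hcut := hB.1.not_spans
  simp only [Spans, not_forall] at hcut
  obtain ⟨φ, hφB, hφ⟩ := hcut
  have hψ' : ∀ y ∈ T, y ≠ e → G.edgeForm y ψ = 0 := fun y hy hne =>
    hψT y (Finset.mem_insert_of_mem (Finset.mem_erase.2 ⟨hne, hy⟩))
  have hφ' : ∀ y ∈ T, y ≠ e → G.edgeForm y φ = 0 := fun y hy hne =>
    hφB y (Finset.mem_compl.2 fun hyB => hne (hBT y hyB hy))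
  have hψe : G.edgeForm e ψ ≠ 0 := fun h => hψ <| hT ψ fun y hy => by
    by_cases hye : y = e
    exacts [hye ▸ h, hψ' y hy hye]
  have hcomb : G.edgeForm e ψ • φ - G.edgeForm e φ • ψ = 0 := hT _ fun y hy => by
    rw [map_sub, map_smul, map_smul]
    by_cases hye : y = e
    · subst hye
      simp only [smul_eq_mul]
      ring
    · rw [hψ' y hy hye, hφ' y hy hye]
      simp
  have hφx : G.edgeForm x φ = 0 := by
    have := congrArg (G.edgeForm x) hcomb
    rw [map_sub, map_smul, map_smul, hψT x (Finset.mem_insert_self _ _), map_zero, smul_zero,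
      sub_zero, smul_eq_mul] at this
    exact (mul_eq_zero.1 this).resolve_left hψe
  have hns : ¬ G.Spans (insert x Bᶜ) := fun h => hφ <| h φ fun y hy => by
    rcases Finset.mem_insert.1 hy with rfl | hy
    exacts [hφx, hφB y hy]
  obtain ⟨D, hD, hdisj⟩ := exists_isCut_disjoint hconn hunb hns
  rw [Finset.disjoint_left] at hdisj
  have hDB : D ⊆ B := fun y hy => by
    by_contra hyB
    exact hdisj hy (Finset.mem_insert_of_mem (Finset.mem_compl.2 hyB))
  have := hB.2 D hDB hD
  exact hdisj (this ▸ hx) (Finset.mem_insert_self _ _)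

/-- The complement of a broken-bond-free set spans. -/
lemma NoBrokenBond.spans_compl [Fintype V] [Fintype E] [DecidableEq V] [LinearOrder E]
    {G : SignedGraph V E} (hconn : G.Connected) (hunb : G.Unbalanced) {F : Finset E}
    (hF : G.NoBrokenBond F) : G.Spans Fᶜ := by
  by_contra hns
  obtain ⟨B, hB, hdisj⟩ := exists_isCut_disjoint hconn hunb hns
  obtain ⟨B', hB', hbond⟩ := hB.exists_isBond_subset
  refine hF _ ⟨B', hbond, hbond.1.1, rfl⟩ ((Finset.erase_subset _ _).trans (hB'.trans ?_))
  intro y hy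
  by_contra hyF
  exact Finset.disjoint_left.1 hdisj hy (Finset.mem_compl.2 hyF)

/-- A broken-bond-free set extends to one whose complement is a basis of the frame matroid. -/
lemma NoBrokenBond.exists_superset [Fintype V] [Fintype E] [DecidableEq V] [LinearOrder E]
    {G : SignedGraph V E} (hconn : G.Connected) (hunb : G.Unbalanced) {F : Finset E}
    (hF : G.NoBrokenBond F) :
    ∃ F', F ⊆ F' ∧ F'.card = Fintype.card E - Fintype.card V ∧ G.NoBrokenBond F' := by
  classical
  let bases : Finset (Finset E) := Finset.univ.filter fun T =>
    T ⊆ Fᶜ ∧ T.card = Fintype.card V ∧ G.Spans T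
  have hne : bases.Nonempty := by
    obtain ⟨T, hT⟩ := (hF.spans_compl hconn hunb).exists_subset_card_eq
    exact ⟨T, by simpa [bases] using hT⟩
  let wt : E → ℕ := fun e => (Finset.univ.filter (· < e)).card
  have hwt : ∀ {x e : E}, x < e → wt x < wt e := by
    intro x e hxe
    refine Finset.card_lt_card (Finset.ssubset_iff_of_subset ?_ |>.2 ⟨x, by simp [hxe], by simp⟩)
    intro y hy
    simp only [Finset.mem_filter, Finset.mem_univ, true_and] at hy ⊢
    exact hy.trans hxe
  obtain ⟨T, hTmem, hTmin⟩ := bases.exists_min_image (fun T => ∑ e ∈ T, wt e) hne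
  obtain ⟨hTF, hTcard, hT⟩ : T ⊆ Fᶜ ∧ T.card = Fintype.card V ∧ G.Spans T := by
    simpa [bases] using hTmem
  refine ⟨Tᶜ, Finset.subset_compl_comm.1 hTF, by rw [Finset.card_compl, hTcard], ?_⟩
  rintro D ⟨B, hB, hBne, rfl⟩ hDT
  set e := B.max' hBne
  have hBT : ∀ y ∈ B, y ∈ T → y = e := fun y hy hyT => by
    by_contra hye
    exact Finset.mem_compl.1 (hDT (Finset.mem_erase.2 ⟨hye, hy⟩)) hyT
  have heT : e ∈ T := by
    by_contra heT
    refine hB.1.not_spans fun φ hφ => hT φ fun y hy => hφ y (Finset.mem_compl.2 fun hyB => ?_)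
    exact heT (hBT y hyB hy ▸ hy)
  obtain ⟨x, hxD, hxF⟩ := Finset.not_subset.1 (hF _ ⟨B, hB, hBne, rfl⟩)
  obtain ⟨hxe, hxB⟩ := Finset.mem_erase.1 hxD
  have hxT : x ∉ T := Finset.mem_compl.1 (hDT hxD)
  have hlt : x < e := lt_of_le_of_ne (B.le_max' x hxB) hxe
  have hxTe : x ∉ T.erase e := fun h => hxT (Finset.mem_of_mem_erase h)
  have hmem : insert x (T.erase e) ∈ bases := by
    simp only [bases, Finset.mem_filter, Finset.mem_univ, true_and]
    refine ⟨Finset.insert_subset (Finset.mem_compl.2 hxF) ((Finset.erase_subset _ _).trans hTF),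
      ?_, hB.spans_insert_erase hconn hunb hT hBT hxB⟩
    rw [Finset.card_insert_of_notMem hxTe, Finset.card_erase_add_one heT, hTcard]
  have hle := hTmin _ hmem
  rw [Finset.sum_insert hxTe, ← Finset.add_sum_erase T wt heT] at hle
  have := hwt hlt
  omega

end SignedGraph

/-- For a connected unbalanced signed graph `G`, every edge set `F`
containing no broken bond has at most `m - n` edges, and is contained in a
broken-bond-free edge set with exactly `m - n` edges (the broken-bond-free sets form a
homogeneous simplicial complex of top dimension `m - n`). -/
theorem broken_bond_free_complex_homogeneous {V E : Type}
    [Fintype V] [DecidableEq V] [Fintype E] [LinearOrder E]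
    (G : SignedGraph V E) (hconn : G.Connected) (hunb : G.Unbalanced)
    (F : Finset E) (hF : G.NoBrokenBond F) :
    F.card ≤ Fintype.card E - Fintype.card V ∧
    ∃ F' : Finset E, F ⊆ F' ∧ F'.card = Fintype.card E - Fintype.card V ∧
      G.NoBrokenBond F' := by
  obtain ⟨F', hFF', hcard, hF'⟩ := hF.exists_superset hconn hunb
  exact ⟨hcard ▸ Finset.card_le_card hFF', F', hFF', hcard, hF'⟩
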